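/- arXiv:1310.3878 — 2 statements merged into one kernel-verified Lean document; each statement's English description precedes it below -/
import Mathlib

section
/- Over K = ℂ(q) (the field of rational functions, q the variable), the generic mirabolic Hecke algebra ℛ_n (Solomon presentation on generators T_0, …, T_{n−1}) is isomorphic as a K-algebra to the quotient H_n(1,0)/I, where I is the two-sided ideal of the cyclotomic Hecke algebra H_n(1,0) generated by the element y_(∅,2) = (q+1)⁻¹(1 − X + T_1 − XT_1 − T_1X + XT_1X − T_1XT_1 + XT_1XT_1). The isomorphism sends T_0 ↦ q·X − 1 and T_i ↦ T_i for 1 ≤ i ≤ n−1. -/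
noncomputable section

/-- The relations of Solomon's presentation of the mirabolic Hecke algebra `R_n(K,q)`,
on generators `T_0, T_1, …, T_{n-1}` (indexed by `Fin n`). -/
inductive SolomonRel (K : Type) [Field K] (q : K) (n : ℕ) :
    FreeAlgebra K (Fin n) → FreeAlgebra K (Fin n) → Prop
  | quad0 (i : Fin n) (hi : i.val = 0) :
      SolomonRel K q n (FreeAlgebra.ι K i * FreeAlgebra.ι K i)
        ((q - 2) • FreeAlgebra.ι K i + (q - 1) • (1 : FreeAlgebra K (Fin n)))
  | quad (i : Fin n) (hi : 1 ≤ i.val) :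
      SolomonRel K q n (FreeAlgebra.ι K i * FreeAlgebra.ι K i)
        ((q - 1) • FreeAlgebra.ι K i + q • (1 : FreeAlgebra K (Fin n)))
  | braid (i j : Fin n) (hi : 1 ≤ i.val) (hij : i.val + 1 = j.val) :
      SolomonRel K q n (FreeAlgebra.ι K i * FreeAlgebra.ι K j * FreeAlgebra.ι K i)
        (FreeAlgebra.ι K j * FreeAlgebra.ι K i * FreeAlgebra.ι K j)
  | rel4 (i j : Fin n) (hi : i.val = 0) (hj : j.val = 1) :
      SolomonRel K q n
        (FreeAlgebra.ι K i * FreeAlgebra.ι K j * FreeAlgebra.ι K i * FreeAlgebra.ι K j)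
        ((q - 1) • (FreeAlgebra.ι K j * FreeAlgebra.ι K i * FreeAlgebra.ι K j +
            FreeAlgebra.ι K j * FreeAlgebra.ι K i) -
          FreeAlgebra.ι K i * FreeAlgebra.ι K j * FreeAlgebra.ι K i)
  | rel5 (i j : Fin n) (hi : i.val = 0) (hj : j.val = 1) :
      SolomonRel K q n
        (FreeAlgebra.ι K j * FreeAlgebra.ι K i * FreeAlgebra.ι K j * FreeAlgebra.ι K i)
        ((q - 1) • (FreeAlgebra.ι K j * FreeAlgebra.ι K i * FreeAlgebra.ι K j +
            FreeAlgebra.ι K i * FreeAlgebra.ι K j) -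
          FreeAlgebra.ι K i * FreeAlgebra.ι K j * FreeAlgebra.ι K i)
  | comm (i j : Fin n) (hij : i.val + 2 ≤ j.val ∨ j.val + 2 ≤ i.val) :
      SolomonRel K q n (FreeAlgebra.ι K i * FreeAlgebra.ι K j)
        (FreeAlgebra.ι K j * FreeAlgebra.ι K i)

/-- The mirabolic Hecke algebra `R_n(K,q)`, presented by Solomon's relations. -/
abbrev MirabolicHecke (K : Type) [Field K] (q : K) (n : ℕ) : Type :=
  RingQuot (SolomonRel K q n)

/-- The generator `T_i` of the mirabolic Hecke algebra. -/
def MirabolicHecke.T {K : Type} [Field K] {q : K} {n : ℕ} (i : Fin n) :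
    MirabolicHecke K q n :=
  RingQuot.mkAlgHom K (SolomonRel K q n) (FreeAlgebra.ι K i)

/-- The relations of the cyclotomic Hecke algebra `H_n(1,0)` on generators
`X, T_1, …, T_{n-1}`, indexed by `Fin n` with `0 ↦ X` and `i ↦ T_i` for `1 ≤ i ≤ n-1`. -/
inductive CycloRel (K : Type) [Field K] (q : K) (n : ℕ) :
    FreeAlgebra K (Fin n) → FreeAlgebra K (Fin n) → Prop
  | quad (i : Fin n) (hi : 1 ≤ i.val) :
      CycloRel K q n (FreeAlgebra.ι K i * FreeAlgebra.ι K i)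
        ((q - 1) • FreeAlgebra.ι K i + q • (1 : FreeAlgebra K (Fin n)))
  | braid (i j : Fin n) (hi : 1 ≤ i.val) (hij : i.val + 1 = j.val) :
      CycloRel K q n (FreeAlgebra.ι K i * FreeAlgebra.ι K j * FreeAlgebra.ι K i)
        (FreeAlgebra.ι K j * FreeAlgebra.ι K i * FreeAlgebra.ι K j)
  | comm (i j : Fin n) (hi : 1 ≤ i.val) (hj : 1 ≤ j.val)
      (hij : i.val + 2 ≤ j.val ∨ j.val + 2 ≤ i.val) :
      CycloRel K q n (FreeAlgebra.ι K i * FreeAlgebra.ι K j)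
        (FreeAlgebra.ι K j * FreeAlgebra.ι K i)
  | Xcomm (x i : Fin n) (hx : x.val = 0) (hi : 2 ≤ i.val) :
      CycloRel K q n (FreeAlgebra.ι K x * FreeAlgebra.ι K i)
        (FreeAlgebra.ι K i * FreeAlgebra.ι K x)
  | Xbraid (x t : Fin n) (hx : x.val = 0) (ht : t.val = 1) :
      CycloRel K q n
        (FreeAlgebra.ι K x * FreeAlgebra.ι K t * FreeAlgebra.ι K x * FreeAlgebra.ι K t)
        (FreeAlgebra.ι K t * FreeAlgebra.ι K x * FreeAlgebra.ι K t * FreeAlgebra.ι K x)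
  | Xidem (x : Fin n) (hx : x.val = 0) :
      CycloRel K q n (FreeAlgebra.ι K x * FreeAlgebra.ι K x) (FreeAlgebra.ι K x)

/-- The cyclotomic Hecke algebra `H_n(1,0)` over `K`. -/
abbrev CycloHecke (K : Type) [Field K] (q : K) (n : ℕ) : Type := RingQuot (CycloRel K q n)

/-- The generators of `H_n(1,0)`: `gen 0 = X`, `gen i = T_i` for `i ≥ 1`. -/
def CycloHecke.gen {K : Type} [Field K] {q : K} {n : ℕ} (i : Fin n) : CycloHecke K q n :=
  RingQuot.mkAlgHom K (CycloRel K q n) (FreeAlgebra.ι K i)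

section Stmt6

variable (n : ℕ)

/-- The field `ℂ(q)` of rational functions. -/
local notation "K" => RatFunc ℂ

/-- The generic parameter `q`. -/
local notation "q" => (RatFunc.X : RatFunc ℂ)

/-- The element `y_(∅,2)` of the cyclotomic Hecke algebra `H_n(1,0)` (for `n ≥ 2`). -/
def yEmptyTwo (hn : 1 < n) : CycloHecke K q n :=
  letI X : CycloHecke K q n := CycloHecke.gen ⟨0, by omega⟩
  letI T1 : CycloHecke K q n := CycloHecke.gen ⟨1, hn⟩
  (q + 1)⁻¹ • (1 - X + T1 - X * T1 - T1 * X + X * T1 * X - T1 * X * T1 + X * T1 * X * T1)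

/-- The quotient of `H_n(1,0)` by the two-sided ideal generated by `y_(∅,2)`,
realized as a `RingQuot` by the relation `y_(∅,2) = 0`. -/
abbrev CycloQuot (hn : 1 < n) : Type :=
  RingQuot (fun a b : CycloHecke K q n => a = yEmptyTwo n hn ∧ b = 0)

section Reparametrization

variable {n} {F A : Type} [Field F] [Ring A] [Algebra F A] {c : F}

/-- The numerator of `y_(∅,2)`, evaluated at elements `x`, `t` of a ring. -/
def yPoly (x t : A) : A :=
  1 - x + t - x * t - t * x + x * t * x - t * x * t + x * t * x * t

lemma map_yPoly {B : Type} [Ring B] [Algebra F B] (f : A →ₐ[F] B) (x t : A) :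
    f (yPoly x t) = yPoly (f x) (f t) := by
  simp [yPoly]

/-- With `s = c x - 1`, the first mixed Solomon relation for `s`, `t` is `c² yPoly x t = 0`. -/
lemma solomon_rel_left {x t : A} (ht : t * t = (c - 1) • t + c • (1 : A)) :
    (c • x - 1) * t * (c • x - 1) * t -
      ((c - 1) • (t * (c • x - 1) * t + t * (c • x - 1)) - (c • x - 1) * t * (c • x - 1)) =
    c ^ 2 • yPoly x t := by
  simp only [yPoly, mul_sub, sub_mul, mul_add, smul_mul_assoc, mul_smul_comm, one_mul, mul_one,
    mul_assoc, ht, smul_sub, smul_add]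
  module

/-- With `s = c x - 1`, the second mixed Solomon relation for `s`, `t` is
`c² (yPoly x t + t x t x - x t x t) = 0`. -/
lemma solomon_rel_right {x t : A} (ht : t * t = (c - 1) • t + c • (1 : A)) :
    t * (c • x - 1) * t * (c • x - 1) -
      ((c - 1) • (t * (c • x - 1) * t + (c • x - 1) * t) - (c • x - 1) * t * (c • x - 1)) =
    c ^ 2 • (yPoly x t + t * x * t * x - x * t * x * t) := by
  simp only [yPoly, mul_sub, sub_mul, add_mul, smul_mul_assoc, mul_smul_comm, one_mul, mul_one,
    mul_assoc, ht, smul_sub, smul_add]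
  module

/-- The substitution `T_0 = c X - 1`. -/
def solomonOfCyclo (c : F) (a : Fin n → A) (i : Fin n) : A :=
  if i.val = 0 then c • a i - 1 else a i

/-- The substitution `X = c⁻¹ (T_0 + 1)`. -/
def cycloOfSolomon (c : F) (b : Fin n → A) (i : Fin n) : A :=
  if i.val = 0 then c⁻¹ • (b i + 1) else b i

@[simp]
lemma solomonOfCyclo_cycloOfSolomon (hc : c ≠ 0) (b : Fin n → A) :
    solomonOfCyclo c (cycloOfSolomon c b) = b := by
  ext i
  by_cases hi : i.val = 0 <;> simp [solomonOfCyclo, cycloOfSolomon, hi, hc]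

@[simp]
lemma cycloOfSolomon_solomonOfCyclo (hc : c ≠ 0) (a : Fin n → A) :
    cycloOfSolomon c (solomonOfCyclo c a) = a := by
  ext i
  by_cases hi : i.val = 0 <;> simp [solomonOfCyclo, cycloOfSolomon, hi, hc]

lemma solomonOfCyclo_of_pos (a : Fin n → A) {i : Fin n} (hi : 1 ≤ i.val) :
    solomonOfCyclo c a i = a i := if_neg (by omega)

lemma solomonOfCyclo_of_zero (a : Fin n → A) {i : Fin n} (hi : i.val = 0) :
    solomonOfCyclo c a i = c • a i - 1 := if_pos hi

lemma map_solomonOfCyclo {B : Type} [Ring B] [Algebra F B] (f : A →ₐ[F] B) (a : Fin n → A) :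
    f ∘ solomonOfCyclo c a = solomonOfCyclo c (f ∘ a) := by
  ext i
  by_cases hi : i.val = 0 <;> simp [solomonOfCyclo, hi]

lemma map_cycloOfSolomon {B : Type} [Ring B] [Algebra F B] (f : A →ₐ[F] B) (b : Fin n → A) :
    f ∘ cycloOfSolomon c b = cycloOfSolomon c (f ∘ b) := by
  ext i
  by_cases hi : i.val = 0 <;> simp [cycloOfSolomon, hi]

lemma solomonRel_of_cycloRel (hn : 1 < n) {a : Fin n → A}
    (ha : ∀ ⦃u v⦄, CycloRel F c n u v → FreeAlgebra.lift F a u = FreeAlgebra.lift F a v)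
    (hy : yPoly (a ⟨0, Nat.zero_lt_of_lt hn⟩) (a ⟨1, hn⟩) = 0) ⦃u v : FreeAlgebra F (Fin n)⦄
    (h : SolomonRel F c n u v) :
    FreeAlgebra.lift F (solomonOfCyclo c a) u = FreeAlgebra.lift F (solomonOfCyclo c a) v := by
  have quad (i : Fin n) (hi : 1 ≤ i.val) : a i * a i = (c - 1) • a i + c • (1 : A) := by
    simpa using ha (.quad i hi)
  cases h with
  | quad0 i hi =>
    have hx : a i * a i = a i := by simpa using ha (.Xidem i hi)
    simp only [map_mul, map_add, map_smul, map_one, FreeAlgebra.lift_ι_apply,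
      solomonOfCyclo_of_zero a hi, mul_sub, sub_mul, smul_mul_assoc, mul_smul_comm, hx,
      one_mul, mul_one]
    module
  | quad i hi => simpa [solomonOfCyclo_of_pos a hi] using quad i hi
  | braid i j hi hij =>
    simpa [solomonOfCyclo_of_pos a hi, solomonOfCyclo_of_pos a (show 1 ≤ j.val by omega)]
      using ha (.braid i j hi hij)
  | rel4 i j hi hj =>
    obtain rfl : i = ⟨0, Nat.zero_lt_of_lt hn⟩ := Fin.ext hi
    obtain rfl : j = ⟨1, hn⟩ := Fin.ext hj
    rw [← sub_eq_zero]
    simp only [map_mul, map_add, map_sub, map_smul, FreeAlgebra.lift_ι_apply,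
      solomonOfCyclo_of_zero a hi, solomonOfCyclo_of_pos a hj.ge]
    rw [solomon_rel_left (quad _ hj.ge), hy, smul_zero]
  | rel5 i j hi hj =>
    have hb := ha (.Xbraid i j hi hj)
    obtain rfl : i = ⟨0, Nat.zero_lt_of_lt hn⟩ := Fin.ext hi
    obtain rfl : j = ⟨1, hn⟩ := Fin.ext hj
    simp only [map_mul, FreeAlgebra.lift_ι_apply] at hb
    rw [← sub_eq_zero]
    simp only [map_mul, map_add, map_sub, map_smul, FreeAlgebra.lift_ι_apply,
      solomonOfCyclo_of_zero a hi, solomonOfCyclo_of_pos a hj.ge]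
    rw [solomon_rel_right (quad _ hj.ge), hy, hb, zero_add, sub_self, smul_zero]
  | comm i j hij =>
    have comm_zero (i j : Fin n) (hi : i.val = 0) (hj : 2 ≤ j.val) : a i * a j = a j * a i := by
      simpa using ha (.Xcomm i j hi hj)
    simp only [map_mul, FreeAlgebra.lift_ι_apply]
    rcases Nat.eq_zero_or_pos i.val with hi | hi
    · rw [solomonOfCyclo_of_zero a hi, solomonOfCyclo_of_pos a (show 1 ≤ j.val by omega)]
      simp [mul_sub, sub_mul, comm_zero i j hi (by omega)]
    · rcases Nat.eq_zero_or_pos j.val with hj | hj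
      · rw [solomonOfCyclo_of_zero a hj, solomonOfCyclo_of_pos a hi]
        simp [mul_sub, sub_mul, comm_zero j i hj (by omega)]
      · simpa [solomonOfCyclo_of_pos a hi, solomonOfCyclo_of_pos a hj]
          using ha (.comm i j hi hj hij)

lemma yPoly_eq_zero_of_solomonRel (hc : c ≠ 0) (hn : 1 < n) {a : Fin n → A}
    (h : ∀ ⦃u v⦄, SolomonRel F c n u v →
      FreeAlgebra.lift F (solomonOfCyclo c a) u = FreeAlgebra.lift F (solomonOfCyclo c a) v) :
    yPoly (a ⟨0, Nat.zero_lt_of_lt hn⟩) (a ⟨1, hn⟩) = 0 := by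
  have quad := h (.quad ⟨1, hn⟩ le_rfl)
  have rel := sub_eq_zero.mpr (h (.rel4 ⟨0, Nat.zero_lt_of_lt hn⟩ ⟨1, hn⟩ rfl rfl))
  simp only [map_mul, map_add, map_sub, map_smul, map_one, FreeAlgebra.lift_ι_apply,
    solomonOfCyclo_of_zero a (i := ⟨0, _⟩) rfl,
    solomonOfCyclo_of_pos a (i := ⟨1, hn⟩) le_rfl] at quad rel
  rw [solomon_rel_left quad] at rel
  exact (smul_eq_zero_iff_right (pow_ne_zero 2 hc)).mp rel

lemma cycloRel_of_solomonRel (hc : c ≠ 0) {a : Fin n → A}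
    (h : ∀ ⦃u v⦄, SolomonRel F c n u v →
      FreeAlgebra.lift F (solomonOfCyclo c a) u = FreeAlgebra.lift F (solomonOfCyclo c a) v)
    ⦃u v : FreeAlgebra F (Fin n)⦄ (huv : CycloRel F c n u v) :
    FreeAlgebra.lift F a u = FreeAlgebra.lift F a v := by
  cases huv with
  | quad i hi => simpa [solomonOfCyclo_of_pos a hi] using h (.quad i hi)
  | braid i j hi hij =>
    simpa [solomonOfCyclo_of_pos a hi, solomonOfCyclo_of_pos a (show 1 ≤ j.val by omega)]
      using h (.braid i j hi hij)
  | comm i j hi hj hij =>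
    simpa [solomonOfCyclo_of_pos a hi, solomonOfCyclo_of_pos a hj] using h (.comm i j hij)
  | Xcomm x i hx hi =>
    simpa [solomonOfCyclo_of_zero a hx, solomonOfCyclo_of_pos a (show 1 ≤ i.val by omega),
      mul_sub, sub_mul, hc] using h (.comm x i (by omega))
  | Xbraid x t hx ht =>
    have hy := yPoly_eq_zero_of_solomonRel hc (ht ▸ t.isLt) h
    have quad := h (.quad t ht.ge)
    have rel := sub_eq_zero.mpr (h (.rel5 x t hx ht))
    simp only [map_mul, map_add, map_sub, map_smul, map_one, FreeAlgebra.lift_ι_apply,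
      solomonOfCyclo_of_zero a hx, solomonOfCyclo_of_pos a ht.ge] at quad rel ⊢
    rw [solomon_rel_right quad, smul_eq_zero_iff_right (pow_ne_zero 2 hc)] at rel
    rw [show (⟨0, _⟩ : Fin n) = x from Fin.ext hx.symm,
      show (⟨1, _⟩ : Fin n) = t from Fin.ext ht.symm] at hy
    rw [hy, zero_add, sub_eq_zero] at rel
    exact rel.symm
  | Xidem x hx =>
    have quad := sub_eq_zero.mpr (h (.quad0 x hx))
    simp only [map_mul, map_add, map_smul, map_one, FreeAlgebra.lift_ι_apply,
      solomonOfCyclo_of_zero a hx] at quad ⊢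
    have key : c ^ 2 • (a x * a x - a x) = 0 := by
      rw [← quad]
      simp only [mul_sub, sub_mul, smul_mul_assoc, mul_smul_comm, one_mul, mul_one]
      module
    exact sub_eq_zero.mp ((smul_eq_zero_iff_right (pow_ne_zero 2 hc)).mp key)

lemma lift_comp_mkAlgHom_rel {r : FreeAlgebra F (Fin n) → FreeAlgebra F (Fin n) → Prop}
    (f : RingQuot r →ₐ[F] A) ⦃u v : FreeAlgebra F (Fin n)⦄ (h : r u v) :
    FreeAlgebra.lift F (fun i => f (RingQuot.mkAlgHom F r (FreeAlgebra.ι F i))) u =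
      FreeAlgebra.lift F (fun i => f (RingQuot.mkAlgHom F r (FreeAlgebra.ι F i))) v := by
  have hf : FreeAlgebra.lift F (fun i => f (RingQuot.mkAlgHom F r (FreeAlgebra.ι F i))) =
      f.comp (RingQuot.mkAlgHom F r) := by
    ext i
    simp
  rw [hf]
  exact congrArg f (RingQuot.mkAlgHom_rel F h)

/-- The quotient of the cyclotomic Hecke algebra by the two-sided ideal generated by `y`. -/
abbrev CycloQuotBy (y : CycloHecke F c n) : Type :=
  RingQuot (fun a b : CycloHecke F c n => a = y ∧ b = 0)

/-- The quotient map onto `CycloQuotBy y`. -/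
def CycloQuotBy.mk (y : CycloHecke F c n) : CycloHecke F c n →ₐ[F] CycloQuotBy y :=
  RingQuot.mkAlgHom F _

lemma yPoly_mk_eq_zero (hn : 1 < n) {d : F} (hd : d ≠ 0) {y : CycloHecke F c n} (hyE : y =
      d • yPoly (CycloHecke.gen ⟨0, Nat.zero_lt_of_lt hn⟩) (CycloHecke.gen ⟨1, hn⟩)) :
    yPoly (CycloQuotBy.mk y (CycloHecke.gen ⟨0, Nat.zero_lt_of_lt hn⟩))
      (CycloQuotBy.mk y (CycloHecke.gen ⟨1, hn⟩)) = 0 := by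
  have h0 : CycloQuotBy.mk y y = CycloQuotBy.mk y 0 := RingQuot.mkAlgHom_rel F ⟨rfl, rfl⟩
  replace h0 := (congrArg (CycloQuotBy.mk y) hyE).symm.trans h0
  rw [map_smul, map_zero, smul_eq_zero_iff_right hd] at h0
  rw [← h0]
  exact (map_yPoly (F := F) (A := CycloHecke F c n) (B := CycloQuotBy y)
    (CycloQuotBy.mk y) _ _).symm

/-- The comparison isomorphism, over a field and for a nonzero multiple `y` of `y_(∅,2)`. -/
theorem exists_mirabolicHecke_equiv (hc : c ≠ 0) (hn : 1 < n) {d : F} (hd : d ≠ 0)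
    {y : CycloHecke F c n} (hyE : y =
      d • yPoly (CycloHecke.gen ⟨0, Nat.zero_lt_of_lt hn⟩) (CycloHecke.gen ⟨1, hn⟩)) :
    ∃ φ : MirabolicHecke F c n ≃ₐ[F] RingQuot (fun a b : CycloHecke F c n => a = y ∧ b = 0),
      φ (MirabolicHecke.T ⟨0, Nat.zero_lt_of_lt hn⟩) =
        RingQuot.mkAlgHom F _ (c • CycloHecke.gen ⟨0, Nat.zero_lt_of_lt hn⟩ - 1) ∧
      ∀ i : Fin n, 1 ≤ i.val →
        φ (MirabolicHecke.T i) = RingQuot.mkAlgHom F _ (CycloHecke.gen i) := by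
  let π : CycloHecke F c n →ₐ[F] CycloQuotBy y := CycloQuotBy.mk y
  let b := solomonOfCyclo c fun i : Fin n => π (CycloHecke.gen i)
  have hb : ∀ ⦃u v⦄, SolomonRel F c n u v → FreeAlgebra.lift F b u = FreeAlgebra.lift F b v :=
    solomonRel_of_cycloRel (A := CycloQuotBy y) hn
      (lift_comp_mkAlgHom_rel (A := CycloQuotBy y) π) (yPoly_mk_eq_zero hn hd hyE)
  let f : MirabolicHecke F c n →ₐ[F] CycloQuotBy y :=
    RingQuot.liftAlgHom F ⟨FreeAlgebra.lift F b, hb⟩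
  let a := cycloOfSolomon c (MirabolicHecke.T : Fin n → MirabolicHecke F c n)
  have ha : ∀ ⦃u v⦄, SolomonRel F c n u v →
      FreeAlgebra.lift F (solomonOfCyclo c a) u = FreeAlgebra.lift F (solomonOfCyclo c a) v := by
    rw [solomonOfCyclo_cycloOfSolomon hc]
    exact lift_comp_mkAlgHom_rel (AlgHom.id F (MirabolicHecke F c n))
  let g₀ : CycloHecke F c n →ₐ[F] MirabolicHecke F c n :=
    RingQuot.liftAlgHom F ⟨FreeAlgebra.lift F a, cycloRel_of_solomonRel hc ha⟩
  have hg₀ (i : Fin n) : g₀ (CycloHecke.gen i) = a i := by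
    simp [g₀, CycloHecke.gen]
  let g : CycloQuotBy y →ₐ[F] MirabolicHecke F c n :=
    RingQuot.liftAlgHom F ⟨g₀, by
      rintro u v ⟨rfl, rfl⟩
      rw [hyE, map_smul, map_yPoly, hg₀, hg₀, yPoly_eq_zero_of_solomonRel hc hn ha, smul_zero,
        map_zero]⟩
  have hg (z : CycloHecke F c n) : g (π z) = g₀ z :=
    RingQuot.liftAlgHom_mkAlgHom_apply F _ _ z
  have hf (i : Fin n) : f (MirabolicHecke.T i) = b i := by
    simp [f, MirabolicHecke.T]
  refine ⟨AlgEquiv.ofAlgHom f g ?_ ?_, ?_, fun i hi => ?_⟩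
  · refine RingQuot.ringQuot_ext' F _ _ (RingQuot.ringQuot_ext' F _ _ ?_)
    refine FreeAlgebra.hom_ext (funext fun i => ?_)
    change f (g (π (CycloHecke.gen i))) = π (CycloHecke.gen i)
    rw [hg, hg₀]
    refine (congrFun (map_cycloOfSolomon (F := F) (A := MirabolicHecke F c n)
      (B := CycloQuotBy y) f MirabolicHecke.T) i).trans ?_
    rw [show f ∘ MirabolicHecke.T = b from funext hf]
    exact congrFun (cycloOfSolomon_solomonOfCyclo hc _) i
  · refine RingQuot.ringQuot_ext' F _ _ (FreeAlgebra.hom_ext (funext fun i => ?_))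
    change g (f (MirabolicHecke.T i)) = MirabolicHecke.T i
    rw [hf]
    refine (congrFun (map_solomonOfCyclo (F := F) (A := CycloQuotBy y)
      (B := MirabolicHecke F c n) g fun i => π (CycloHecke.gen i)) i).trans ?_
    rw [show (g ∘ fun i => π (CycloHecke.gen i)) = a from funext fun i => (hg _).trans (hg₀ i)]
    exact congrFun (solomonOfCyclo_cycloOfSolomon hc _) i
  · refine (hf _).trans ((solomonOfCyclo_of_zero _ rfl).trans ?_)
    rw [map_sub, map_smul, map_one]
    rfl
  · exact (hf i).trans (solomonOfCyclo_of_pos _ hi)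

end Reparametrization

/-- The generic mirabolic Hecke algebra `ℛ_n` is isomorphic to
`H_n(1,0)/I`, where `I` is the two-sided ideal generated by `y_(∅,2)`; the isomorphism
sends `T_0 ↦ q·X − 1` and `T_i ↦ T_i` for `1 ≤ i ≤ n−1`. -/
theorem mirabolicHecke_iso_cycloQuot (hn : 1 < n) :
    ∃ φ : MirabolicHecke K q n ≃ₐ[K] CycloQuot n hn,
      φ (MirabolicHecke.T ⟨0, by omega⟩) =
        RingQuot.mkAlgHom K _ (q • CycloHecke.gen ⟨0, by omega⟩ - 1) ∧
      ∀ i : Fin n, 1 ≤ i.val →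
        φ (MirabolicHecke.T i) = RingQuot.mkAlgHom K _ (CycloHecke.gen i) := by
  have hq : (q + 1)⁻¹ ≠ 0 := by
    rw [← RatFunc.algebraMap_X, ← map_one (algebraMap (Polynomial ℂ) K), ← map_add]
    exact inv_ne_zero (RatFunc.algebraMap_ne_zero (Polynomial.X_add_C_ne_zero 1))
  exact exists_mirabolicHecke_equiv RatFunc.X_ne_zero hn hq rfl

end Stmt6
end
end

section
/- In the cyclotomic Hecke algebra H_2(1,0) over ℂ(q), the five elements y_(2,∅) = q⁻¹(q+1)⁻¹(T_1XT_1X + XT_1X), y_(11,∅) = (q+1)⁻¹(T_1XT_1X − q·XT_1X), y_(1,1) = q⁻¹(q·X + T_1XT_1 + (q−1)·XT_1X − 2·T_1XT_1X), y_(∅,2) = (q+1)⁻¹(1 − X + T_1 − XT_1 − T_1X + XT_1X − T_1XT_1 + XT_1XT_1), and y_(∅,11) = (q+1)⁻¹(q − q·X − T_1 + XT_1 + T_1X − XT_1X − q⁻¹·T_1XT_1 + q⁻¹·XT_1XT_1) are central idempotents; they are pairwise orthogonal (y·y' = 0 for distinct pairs) and sum to 1. -/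
noncomputable section

section Stmt7

local notation "K" => RatFunc ℂ
local notation "q" => (RatFunc.X : RatFunc ℂ)

/-- The generator `X` of `H_2(1,0)`. -/
def Xg : CycloHecke K q 2 := CycloHecke.gen 0

/-- The generator `T_1` of `H_2(1,0)`. -/
def T1g : CycloHecke K q 2 := CycloHecke.gen 1

/-- The five elements `y_(2,∅), y_(11,∅), y_(1,1), y_(∅,2), y_(∅,11)` of `H_2(1,0)`. -/
def yElt : Fin 5 → CycloHecke K q 2 :=
  ![ (q⁻¹ * (q + 1)⁻¹) • (T1g * Xg * T1g * Xg + Xg * T1g * Xg),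
     (q + 1)⁻¹ • (T1g * Xg * T1g * Xg - q • (Xg * T1g * Xg)),
     q⁻¹ • (q • Xg + T1g * Xg * T1g + (q - 1) • (Xg * T1g * Xg) -
       (2 : K) • (T1g * Xg * T1g * Xg)),
     (q + 1)⁻¹ • (1 - Xg + T1g - Xg * T1g - T1g * Xg + Xg * T1g * Xg - T1g * Xg * T1g +
       Xg * T1g * Xg * T1g),
     (q + 1)⁻¹ • (q • (1 : CycloHecke K q 2) - q • Xg - T1g + Xg * T1g + T1g * Xg -
       Xg * T1g * Xg - q⁻¹ • (T1g * Xg * T1g) + q⁻¹ • (Xg * T1g * Xg * T1g)) ]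

namespace CycloHecke

section Generic

variable {F A : Type*} [Field F] [Ring A] [Algebra F A]

/-- The elements `x` and `t` satisfy the defining relations of `H_2(1,0)` with parameter `c`. -/
structure TwoRelations (c : F) (x t : A) : Prop where
  mul_self_x : x * x = x
  mul_self_t : t * t = (c - 1) • t + c • (1 : A)
  braid : t * (x * (t * x)) = x * (t * (x * t))

/-- The family `yElt`, evaluated at arbitrary elements `x` and `t` of an `F`-algebra. -/
def idempotentFamily (c : F) (x t : A) : Fin 5 → A :=
  ![ (c⁻¹ * (c + 1)⁻¹) • (t * x * t * x + x * t * x),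
     (c + 1)⁻¹ • (t * x * t * x - c • (x * t * x)),
     c⁻¹ • (c • x + t * x * t + (c - 1) • (x * t * x) - (2 : F) • (t * x * t * x)),
     (c + 1)⁻¹ • (1 - x + t - x * t - t * x + x * t * x - t * x * t + x * t * x * t),
     (c + 1)⁻¹ • (c • (1 : A) - c • x - t + x * t + t * x -
       x * t * x - c⁻¹ • (t * x * t) + c⁻¹ • (x * t * x * t)) ]

namespace TwoRelations

variable {c : F} {x t : A}

theorem x_mul_x_mul (h : TwoRelations c x t) (a : A) : x * (x * a) = x * a := by
  rw [← mul_assoc, h.mul_self_x]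

theorem t_mul_t_mul (h : TwoRelations c x t) (a : A) :
    t * (t * a) = (c - 1) • (t * a) + c • a := by
  rw [← mul_assoc, h.mul_self_t, add_mul, smul_mul_assoc, smul_mul_assoc, one_mul]

theorem braid_mul (h : TwoRelations c x t) (a : A) :
    t * (x * (t * (x * a))) = x * (t * (x * (t * a))) := by
  simpa only [mul_assoc] using congrArg (· * a) h.braid

theorem sum_idempotentFamily (h : TwoRelations c x t) (h0 : c ≠ 0) (h1 : c + 1 ≠ 0) :
    ∑ i, idempotentFamily c x t i = 1 := by
  simp only [Fin.sum_univ_five, idempotentFamily, Matrix.cons_val, mul_assoc, h.braid]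
  match_scalars <;> field_simp <;> ring

theorem commute_x_idempotentFamily (h : TwoRelations c x t) (h0 : c ≠ 0) (h1 : c + 1 ≠ 0)
    (i : Fin 5) : Commute x (idempotentFamily c x t i) := by
  rw [commute_iff_eq]
  fin_cases i <;>
    simp only [idempotentFamily, Matrix.cons_val, Fin.zero_eta, Fin.mk_one, Fin.reduceFinMk,
      mul_add, add_mul, mul_sub, sub_mul, smul_mul_assoc, mul_smul_comm, mul_one, one_mul,
      mul_assoc, h.mul_self_x, h.x_mul_x_mul, h.braid] <;>
    match_scalars <;> field_simp <;> ring

theorem commute_t_idempotentFamily (h : TwoRelations c x t) (h0 : c ≠ 0) (h1 : c + 1 ≠ 0)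
    (i : Fin 5) : Commute t (idempotentFamily c x t i) := by
  rw [commute_iff_eq]
  fin_cases i <;>
    simp only [idempotentFamily, Matrix.cons_val, Fin.zero_eta, Fin.mk_one, Fin.reduceFinMk,
      mul_add, add_mul, mul_sub, sub_mul, smul_mul_assoc, mul_smul_comm, mul_one, one_mul,
      mul_assoc, h.mul_self_t, h.t_mul_t_mul, h.braid, h.braid_mul] <;>
    match_scalars <;> field_simp <;> ring

theorem idempotentFamily_mul_of_lt (h : TwoRelations c x t) (h0 : c ≠ 0) (h1 : c + 1 ≠ 0)
    {i j : Fin 5} (hij : i < j) :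
    idempotentFamily c x t i * idempotentFamily c x t j = 0 := by
  fin_cases i <;> fin_cases j <;> first
  | exact absurd hij (by decide)
  | simp only [idempotentFamily, Matrix.cons_val, Fin.zero_eta, Fin.mk_one, Fin.reduceFinMk,
      mul_add, add_mul, mul_sub, sub_mul, smul_mul_assoc, mul_smul_comm, mul_one, one_mul,
      mul_assoc, h.mul_self_x, h.x_mul_x_mul, h.mul_self_t, h.t_mul_t_mul, h.braid, h.braid_mul]
    match_scalars <;> field_simp <;> ring

end TwoRelations

end Generic

theorem mem_center_of_commute_gen {F : Type} [Field F] {c : F} {n : ℕ} {a : CycloHecke F c n}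
    (h : ∀ i, Commute (gen i) a) : a ∈ Subalgebra.center F (CycloHecke F c n) := by
  rw [Subalgebra.mem_center_iff]
  intro b
  obtain ⟨f, rfl⟩ := RingQuot.mkAlgHom_surjective F _ b
  induction f using FreeAlgebra.induction with
  | grade0 r => rw [AlgHom.commutes]; exact Algebra.commutes r a
  | grade1 i => exact h i
  | mul f g hf hg => rw [map_mul]; exact Commute.mul_left hf hg
  | add f g hf hg => rw [map_add]; exact Commute.add_left hf hg

theorem twoRelations_gen {F : Type} [Field F] (c : F) :
    TwoRelations c (gen 0 : CycloHecke F c 2) (gen 1) where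
  mul_self_x := by
    simpa [gen] using RingQuot.mkAlgHom_rel F (CycloRel.Xidem 0 rfl : CycloRel F c 2 _ _)
  mul_self_t := by
    simpa [gen] using RingQuot.mkAlgHom_rel F
      (CycloRel.quad 1 le_rfl : CycloRel F c 2 _ _)
  braid := by
    simpa [gen, mul_assoc] using (RingQuot.mkAlgHom_rel F
      (CycloRel.Xbraid 0 1 rfl rfl : CycloRel F c 2 _ _)).symm

end CycloHecke

theorem ratFuncX_add_one_ne_zero : q + 1 ≠ 0 := fun h => by
  have h' : algebraMap (Polynomial ℂ) K (Polynomial.X + Polynomial.C 1) = 0 := by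
    simpa using h
  exact Polynomial.X_add_C_ne_zero (1 : ℂ)
    ((map_eq_zero_iff _ (RatFunc.algebraMap_injective ℂ)).1 h')

theorem yElt_eq_idempotentFamily : yElt = CycloHecke.idempotentFamily q Xg T1g := rfl

/-- The five elements `y_(2,∅), y_(11,∅), y_(1,1), y_(∅,2), y_(∅,11)`
of `H_2(1,0)` are central idempotents, pairwise orthogonal, and sum to `1`. -/
theorem yElt_central_idempotents :
    (∀ i : Fin 5, yElt i ∈ Subalgebra.center K (CycloHecke K q 2)) ∧
    (∀ i : Fin 5, IsIdempotentElem (yElt i)) ∧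
    (∀ i j : Fin 5, i ≠ j → yElt i * yElt j = 0) ∧
    (∑ i : Fin 5, yElt i) = 1 := by
  have h : CycloHecke.TwoRelations q Xg T1g := CycloHecke.twoRelations_gen q
  have h0 : q ≠ 0 := RatFunc.X_ne_zero
  have h1 := ratFuncX_add_one_ne_zero
  rw [yElt_eq_idempotentFamily]
  have hc (i : Fin 5) : CycloHecke.idempotentFamily q Xg T1g i ∈
      Subalgebra.center K (CycloHecke K q 2) :=
    CycloHecke.mem_center_of_commute_gen <| Fin.forall_fin_two.2
      ⟨h.commute_x_idempotentFamily h0 h1 i, h.commute_t_idempotentFamily h0 h1 i⟩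
  have ho (i j : Fin 5) (hij : i ≠ j) : CycloHecke.idempotentFamily q Xg T1g i *
      CycloHecke.idempotentFamily q Xg T1g j = 0 := by
    rcases hij.lt_or_gt with hlt | hlt
    · exact h.idempotentFamily_mul_of_lt h0 h1 hlt
    · rw [Subalgebra.mem_center_iff.1 (hc j)]
      exact h.idempotentFamily_mul_of_lt h0 h1 hlt
  have hs := h.sum_idempotentFamily h0 h1
  exact ⟨hc, (CompleteOrthogonalIdempotents.iff_ortho_complete.2
    ⟨fun i j hij => ho i j hij, hs⟩).idem, ho, hs⟩

end Stmt7
end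
end
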